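/- (Sufficiency part of the equality case of von Neumann's inequality for tensors.) Let X, Y be order-D real tensors of the same size, and suppose there exist orthogonal matrices W^(d) ∈ ℝ^{n_d × n_d} for d = 1,…,D and tensors S_X, S_Y of the same size such that X = S_X ×_1 W^(1) ⋯ ×_D W^(D) and Y = S_Y ×_1 W^(1) ⋯ ×_D W^(D), where for every mode d: (i) the rows of (S_X)_(d) are pairwise orthogonal with nonincreasing Euclidean norms, and likewise for (S_Y)_(d); and (ii) for every row index k, either the k-th row of (S_X)_(d) is a nonnegative scalar multiple of the k-th row of (S_Y)_(d), or the k-th row of (S_Y)_(d) is a nonnegative scalar multiple of the k-th row of (S_X)_(d). Then ⟨X, Y⟩ = ∑_{k=1}^{n d} σ^(d)_k(X) · σ^(d)_k(Y) for every mode d = 1,…,D. -/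

import Mathlib

open scoped BigOperators Matrix

/-- The entries of `v` sorted in nonincreasing order. -/
noncomputable def sortDesc {m : ℕ} (v : Fin m → ℝ) : Fin m → ℝ :=
  fun k => (v ∘ Tuple.sort v) k.rev

theorem gram_isHermitian {m : ℕ} {J : Type*} [Fintype J]
    (A : Matrix (Fin m) J ℝ) : (A * Aᵀ).IsHermitian := by
  ext i j
  simp [Matrix.conjTranspose_apply, Matrix.mul_apply, Matrix.transpose_apply, mul_comm]

/-- Singular values of a real matrix `A`: the square roots of the eigenvalues of
the positive semidefinite matrix `A * Aᵀ`, in nonincreasing order. -/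
noncomputable def singularValues {m : ℕ} {J : Type*} [Fintype J]
    (A : Matrix (Fin m) J ℝ) : Fin m → ℝ :=
  fun k => Real.sqrt (sortDesc (gram_isHermitian A).eigenvalues k)

variable {D : ℕ} {n : Fin D → ℕ}

/-- Inner product of two tensors. -/
noncomputable def tinner (X Y : (∀ d, Fin (n d)) → ℝ) : ℝ :=
  ∑ i : ∀ d, Fin (n d), X i * Y i

/-- Mode-`d` matricization of the tensor `X`. -/
def matricize (X : (∀ d, Fin (n d)) → ℝ) (d : Fin D) :
    Matrix (Fin (n d)) (∀ d' : {d' : Fin D // d' ≠ d}, Fin (n d')) ℝ :=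
  Matrix.of fun k j =>
    X (fun d' => if h : d' = d then Fin.cast (congrArg n h.symm) k else j ⟨d', h⟩)

/-- Mode-`d` singular values of a tensor. -/
noncomputable def modeSV (X : (∀ d, Fin (n d)) → ℝ) (d : Fin D) : Fin (n d) → ℝ :=
  singularValues (matricize X d)

/-- The multilinear (Tucker) product `X ×₁ U 1 ×₂ ⋯ ×_D U D`. -/
noncomputable def tuckerMul (X : (∀ d, Fin (n d)) → ℝ)
    (U : ∀ d, Matrix (Fin (n d)) (Fin (n d)) ℝ) : (∀ d, Fin (n d)) → ℝ :=
  fun i => ∑ j : ∀ d, Fin (n d), (∏ d, U d (i d) (j d)) * X j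

/-- Rectangular "diagonal" matrix with columns indexed by an arbitrary fintype,
identified with an initial segment of `ℕ` via `Fintype.equivFin`. -/
noncomputable def rectDiagJ {m : ℕ} {J : Type*} [Fintype J]
    (v : Fin m → ℝ) : Matrix (Fin m) J ℝ :=
  Matrix.of fun k j => if ((Fintype.equivFin J) j : ℕ) = (k : ℕ) then v k else 0

theorem sortDesc_antitone {m : ℕ} (v : Fin m → ℝ) : Antitone (sortDesc v) :=
  fun _ _ h => Tuple.monotone_sort v (Fin.rev_le_rev.mpr h)

/-- `sortDesc v` is the only nonincreasing rearrangement of `v`. -/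
theorem sortDesc_eq_of_antitone {m : ℕ} {v w : Fin m → ℝ} (hw : Antitone w)
    (h : Finset.univ.val.map v = Finset.univ.val.map w) : sortDesc v = w := by
  have hv : Finset.univ.val.map (sortDesc v) = Finset.univ.val.map v := by
    have hcomp : sortDesc v = v ∘ (Fin.revPerm.trans (Tuple.sort v)) := rfl
    rw [hcomp, ← Multiset.map_map, Multiset.map_univ_val_equiv]
  have hp : (List.ofFn (sortDesc v)).Perm (List.ofFn w) := by
    simpa only [Fin.univ_val_map, Multiset.coe_eq_coe] using hv.trans h
  exact List.ofFn_injective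
    (hp.eq_of_sortedGE (sortDesc_antitone v).sortedGE_ofFn hw.sortedGE_ofFn)

/-- If `B` has pairwise orthogonal rows of nonincreasing norm, then the singular values of any `A`
whose Gram matrix is orthogonally conjugate to that of `B` are the row norms of `B`. -/
theorem singularValues_eq_row_norm {m : ℕ} {J : Type*} [Fintype J]
    {A B : Matrix (Fin m) J ℝ} {W : Matrix (Fin m) (Fin m) ℝ} (hW : W * Wᵀ = 1)
    (hA : A * Aᵀ = W * (B * Bᵀ) * Wᵀ)
    (horth : ∀ k k', k ≠ k' → ∑ j, B k j * B k' j = 0)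
    (hmono : Antitone fun k => Real.sqrt (∑ j, B k j ^ 2)) (k : Fin m) :
    singularValues A k = Real.sqrt (∑ j, B k j ^ 2) := by
  have hdiag : B * Bᵀ = Matrix.diagonal fun k => ∑ j, B k j ^ 2 := by
    ext i i'
    rw [Matrix.mul_apply, Matrix.diagonal_apply]
    split_ifs with h
    · subst h
      simp [pow_two]
    · simpa using horth i i' h
  have hchar : (A * Aᵀ).charpoly = (Matrix.diagonal fun k => ∑ j, B k j ^ 2).charpoly := by
    rw [hA, Matrix.charpoly_mul_comm, ← mul_assoc, mul_eq_one_comm.mp hW, one_mul, hdiag]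
  have hroots := (gram_isHermitian A).roots_charpoly_eq_eigenvalues
  rw [hchar, Matrix.charpoly_diagonal, Polynomial.roots_prod _ _
    (Finset.prod_ne_zero_iff.mpr fun i _ => Polynomial.X_sub_C_ne_zero _)] at hroots
  simp only [Polynomial.roots_X_sub_C, Multiset.bind_singleton] at hroots
  have hanti : Antitone fun k => ∑ j, B k j ^ 2 := fun a b hab =>
    (Real.sqrt_le_sqrt_iff (Finset.sum_nonneg fun j _ => sq_nonneg _)).mp (hmono hab)
  rw [singularValues, sortDesc_eq_of_antitone hanti]
  exact hroots.symm

theorem sum_mul_eq_sqrt_mul_sqrt {J : Type*} [Fintype J] {f g : J → ℝ} {c : ℝ} (hc : 0 ≤ c)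
    (h : ∀ j, f j = c * g j) :
    ∑ j, f j * g j = Real.sqrt (∑ j, f j ^ 2) * Real.sqrt (∑ j, g j ^ 2) := by
  have hf : ∑ j, f j ^ 2 = c ^ 2 * ∑ j, g j ^ 2 := by
    rw [Finset.mul_sum]
    exact Finset.sum_congr rfl fun j _ => by rw [h, mul_pow]
  have hg : (0 : ℝ) ≤ ∑ j, g j ^ 2 := Finset.sum_nonneg fun j _ => sq_nonneg _
  rw [hf, Real.sqrt_mul (sq_nonneg c), Real.sqrt_sq hc, mul_assoc, Real.mul_self_sqrt hg,
    Finset.mul_sum]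
  exact Finset.sum_congr rfl fun j _ => by rw [h]; ring

theorem matricize_apply (X : (∀ d, Fin (n d)) → ℝ) (d : Fin D) (k : Fin (n d))
    (j : ∀ d' : {d' : Fin D // d' ≠ d}, Fin (n d')) :
    matricize X d k j = X ((Equiv.piSplitAt d fun d => Fin (n d)).symm (k, j)) := by
  simp only [matricize, Matrix.of_apply]
  congr 1
  funext d'
  rw [Equiv.piSplitAt_symm_apply]
  split_ifs with h
  · subst h
    rfl
  · rfl

theorem sum_piSplitAt (d : Fin D) (f : (∀ d, Fin (n d)) → ℝ) :
    ∑ i, f i = ∑ k, ∑ j, f ((Equiv.piSplitAt d fun d => Fin (n d)).symm (k, j)) := by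
  rw [← Fintype.sum_prod_type', Equiv.sum_comp (Equiv.piSplitAt d fun d => Fin (n d)).symm]

theorem tinner_eq_trace (X Y : (∀ d, Fin (n d)) → ℝ) (d : Fin D) :
    tinner X Y = (matricize X d * (matricize Y d)ᵀ).trace := by
  simp [tinner, sum_piSplitAt d, Matrix.trace, Matrix.mul_apply, matricize_apply]

/-- The Kronecker product of a family of matrices. -/
def kroneckerFamily {ι : Type*} [Fintype ι] {m : ι → ℕ}
    (W : ∀ i, Matrix (Fin (m i)) (Fin (m i)) ℝ) :
    Matrix (∀ i, Fin (m i)) (∀ i, Fin (m i)) ℝ :=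
  Matrix.of fun j j' => ∏ i, W i (j i) (j' i)

theorem kroneckerFamily_transpose_mul_self {ι : Type*} [Fintype ι] [DecidableEq ι] {m : ι → ℕ}
    {W : ∀ i, Matrix (Fin (m i)) (Fin (m i)) ℝ} (hW : ∀ i, (W i)ᵀ * W i = 1) :
    (kroneckerFamily W)ᵀ * kroneckerFamily W = 1 := by
  ext j j'
  simp only [kroneckerFamily, Matrix.mul_apply, Matrix.transpose_apply, Matrix.of_apply,
    ← Finset.prod_mul_distrib]
  rw [← Fintype.prod_sum fun i l => W i l (j i) * W i l (j' i)]
  have hentry : ∀ i, ∑ l, W i l (j i) * W i l (j' i) = if j i = j' i then 1 else 0 := fun i => by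
    rw [← Matrix.one_apply, ← hW i]
    simp [Matrix.mul_apply]
  simp only [hentry, Matrix.one_apply, Finset.prod_boole, Finset.mem_univ, true_imp_iff,
    funext_iff]

theorem matricize_tuckerMul (S : (∀ d, Fin (n d)) → ℝ)
    (W : ∀ d, Matrix (Fin (n d)) (Fin (n d)) ℝ) (d : Fin D) :
    matricize (tuckerMul S W) d = W d * matricize S d *
      (kroneckerFamily fun d' : {d' : Fin D // d' ≠ d} => W d')ᵀ := by
  ext k j
  rw [matricize_apply, tuckerMul, sum_piSplitAt d]
  simp only [Matrix.mul_apply, Finset.sum_mul, Matrix.transpose_apply, kroneckerFamily,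
    Matrix.of_apply, matricize_apply]
  rw [Finset.sum_comm]
  refine Finset.sum_congr rfl fun j' _ => Finset.sum_congr rfl fun k' _ => ?_
  rw [Fintype.prod_eq_mul_prod_subtype_ne _ d]
  have hrest : ∀ d' : {d' : Fin D // d' ≠ d},
      W d' ((Equiv.piSplitAt d fun d => Fin (n d)).symm (k, j) d')
        ((Equiv.piSplitAt d fun d => Fin (n d)).symm (k', j') d') = W d' (j d') (j' d') :=
    fun d' => by simp [Equiv.piSplitAt_symm_apply, d'.2]
  simp only [hrest]
  simp only [Equiv.piSplitAt_symm_apply, dite_true]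
  ring

theorem matricize_tuckerMul_mul_transpose (S T : (∀ d, Fin (n d)) → ℝ)
    {W : ∀ d, Matrix (Fin (n d)) (Fin (n d)) ℝ} (hW : ∀ d, W d * (W d)ᵀ = 1) (d : Fin D) :
    matricize (tuckerMul S W) d * (matricize (tuckerMul T W) d)ᵀ =
      W d * (matricize S d * (matricize T d)ᵀ) * (W d)ᵀ := by
  have hK := kroneckerFamily_transpose_mul_self
    (W := fun d' : {d' : Fin D // d' ≠ d} => W d') fun d' => mul_eq_one_comm.mp (hW d')
  rw [matricize_tuckerMul, matricize_tuckerMul, Matrix.transpose_mul, Matrix.transpose_mul,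
    Matrix.transpose_transpose, Matrix.mul_assoc (W d * _), ← Matrix.mul_assoc _ (kroneckerFamily _), hK,
    Matrix.one_mul]
  simp only [Matrix.mul_assoc]

theorem tinner_tuckerMul (S T : (∀ d, Fin (n d)) → ℝ)
    {W : ∀ d, Matrix (Fin (n d)) (Fin (n d)) ℝ} (hW : ∀ d, W d * (W d)ᵀ = 1) (d : Fin D) :
    tinner (tuckerMul S W) (tuckerMul T W) =
      ∑ k, ∑ j, matricize S d k j * matricize T d k j := by
  rw [tinner_eq_trace _ _ d, matricize_tuckerMul_mul_transpose S T hW, Matrix.trace_mul_comm,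
    ← Matrix.mul_assoc, mul_eq_one_comm.mp (hW d), Matrix.one_mul]
  simp [Matrix.trace, Matrix.mul_apply]

/-- sufficiency part of the equality case of von Neumann's
inequality for tensors. -/
theorem tensor_equality_sufficiency (D : ℕ) (hD : 1 ≤ D) (n : Fin D → ℕ)
    (X Y SX SY : (∀ d, Fin (n d)) → ℝ)
    (W : ∀ d, Matrix (Fin (n d)) (Fin (n d)) ℝ)
    (hW : ∀ d, W d * (W d)ᵀ = 1)
    (hX : X = tuckerMul SX W) (hY : Y = tuckerMul SY W)
    (horthX : ∀ (d : Fin D) (k k' : Fin (n d)), k ≠ k' →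
      ∑ j, matricize SX d k j * matricize SX d k' j = 0)
    (horthY : ∀ (d : Fin D) (k k' : Fin (n d)), k ≠ k' →
      ∑ j, matricize SY d k j * matricize SY d k' j = 0)
    (hmonoX : ∀ d : Fin D,
      Antitone fun k : Fin (n d) => Real.sqrt (∑ j, (matricize SX d k j) ^ 2))
    (hmonoY : ∀ d : Fin D,
      Antitone fun k : Fin (n d) => Real.sqrt (∑ j, (matricize SY d k j) ^ 2))
    (hprop : ∀ (d : Fin D) (k : Fin (n d)),
      (∃ c : ℝ, 0 ≤ c ∧ ∀ j, matricize SX d k j = c * matricize SY d k j) ∨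
      (∃ c : ℝ, 0 ≤ c ∧ ∀ j, matricize SY d k j = c * matricize SX d k j)) :
    ∀ d : Fin D, tinner X Y = ∑ k : Fin (n d), modeSV X d k * modeSV Y d k := by
  intro d
  subst hX hY
  rw [tinner_tuckerMul SX SY hW d]
  refine Finset.sum_congr rfl fun k _ => ?_
  rw [modeSV, modeSV,
    singularValues_eq_row_norm (hW d) (matricize_tuckerMul_mul_transpose SX SX hW d)
      (horthX d) (hmonoX d),
    singularValues_eq_row_norm (hW d) (matricize_tuckerMul_mul_transpose SY SY hW d)
      (horthY d) (hmonoY d)]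
  obtain ⟨c, hc, h⟩ | ⟨c, hc, h⟩ := hprop d k
  · exact sum_mul_eq_sqrt_mul_sqrt hc h
  · rw [mul_comm, ← sum_mul_eq_sqrt_mul_sqrt hc h]
    exact Finset.sum_congr rfl fun j _ => mul_comm _ _
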